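/- For every natural number n there exists an involution σ on the set M_n of perfect matchings of [2n] such that for all M ∈ M_n, cr(M) = ne(σ(M)) and ne(M) = cr(σ(M)). -/

import Mathlib

/-- `M` is a perfect matching of `{1, …, 2n}` (modeled on `Fin (2 * n)`):
a partition of the ground set into pairs. -/
def IsPerfectMatching (n : ℕ) (M : Finset (Finset (Fin (2 * n)))) : Prop :=
  (∀ p ∈ M, p.card = 2) ∧ ∀ i : Fin (2 * n), ∃! p, p ∈ M ∧ i ∈ p

/-- The (ordered) pair of pairs `(p, q)` forms a crossing: `p = {a, b}`, `q = {c, d}` with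
`a < c < b < d`.  Each unordered crossing `{p, q}` satisfies this in exactly one order. -/
def IsCrossing {m : ℕ} (p q : Finset (Fin m)) : Prop :=
  ∃ a b c d : Fin m, p = {a, b} ∧ q = {c, d} ∧ a < c ∧ c < b ∧ b < d

/-- `(p, q)` forms a nesting: `p = {a, b}`, `q = {c, d}` with `c < a < b < d`. -/
def IsNesting {m : ℕ} (p q : Finset (Fin m)) : Prop :=
  ∃ a b c d : Fin m, p = {a, b} ∧ q = {c, d} ∧ c < a ∧ a < b ∧ b < d

/-- `(p, q)` forms an alignment: `p = {a, b}`, `q = {c, d}` with `a < b < c < d`. -/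
def IsAlignment {m : ℕ} (p q : Finset (Fin m)) : Prop :=
  ∃ a b c d : Fin m, p = {a, b} ∧ q = {c, d} ∧ a < b ∧ b < c ∧ c < d

/-- `cr(M)`: the number of crossings of `M`. -/
noncomputable def crCount (n : ℕ) (M : Finset (Finset (Fin (2 * n)))) : ℕ :=
  Nat.card {pq : Finset (Fin (2 * n)) × Finset (Fin (2 * n)) //
    pq.1 ∈ M ∧ pq.2 ∈ M ∧ IsCrossing pq.1 pq.2}

/-- `ne(M)`: the number of nestings of `M`. -/
noncomputable def neCount (n : ℕ) (M : Finset (Finset (Fin (2 * n)))) : ℕ :=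
  Nat.card {pq : Finset (Fin (2 * n)) × Finset (Fin (2 * n)) //
    pq.1 ∈ M ∧ pq.2 ∈ M ∧ IsNesting pq.1 pq.2}

/-- `al(M)`: the number of alignments of `M`. -/
noncomputable def alCount (n : ℕ) (M : Finset (Finset (Fin (2 * n)))) : ℕ :=
  Nat.card {pq : Finset (Fin (2 * n)) × Finset (Fin (2 * n)) //
    pq.1 ∈ M ∧ pq.2 ∈ M ∧ IsAlignment pq.1 pq.2}

open Finset Function

section FixedPointFreeInvolutions

variable {m : ℕ}

/-- The fixed-point-free involutions of `Fin m`; they correspond to perfect matchings. -/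
def FPFInvolution (m : ℕ) : Type :=
  {π : Fin m → Fin m // Involutive π ∧ ∀ i, π i ≠ i}

/-- The number of arcs crossed at its right end by the arc closing at `i`. -/
def closerCrossings (π : Fin m → Fin m) (i : Fin m) : ℕ :=
  #{c | π i < c ∧ c < i ∧ i < π c}

/-- The number of arcs that enclose the arc closing at `i`. -/
def closerNestings (π : Fin m → Fin m) (i : Fin m) : ℕ :=
  #{c | c < π i ∧ π i < i ∧ i < π c}

/-- The left ends of the arcs that are still open just before `b`. -/
def openArcs (π : Fin m → Fin m) (b : Fin m) : Finset (Fin m) :=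
  {c | c < b ∧ b ≤ π c}

theorem mem_openArcs {π : Fin m → Fin m} {b c : Fin m} :
    c ∈ openArcs π b ↔ c < b ∧ b ≤ π c := by
  simp [openArcs]

theorem card_openArcs_add {π : Fin m → Fin m} (hπ : Involutive π) (b : Fin m) :
    #(openArcs π b) + #{c | c < b ∧ π c < c} = #{c | c < b ∧ c < π c} := by
  have hclosed : #{c | c < b ∧ π c < c} = #{c | c < π c ∧ π c < b} := by
    refine card_bij' (fun c _ => π c) (fun c _ => π c) ?_ ?_ ?_ ?_ <;>
      simp [hπ _] <;> tauto
  rw [hclosed, ← card_union_of_disjoint]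
  · congr 1
    ext c
    simp only [openArcs, mem_union, mem_filter, mem_univ, true_and]
    grind
  · rw [disjoint_left]
    simp only [openArcs, mem_filter, mem_univ, true_and]
    grind

theorem card_openArcs_congr {π ρ : Fin m → Fin m} (hπ : Involutive π) (hπ' : ∀ i, π i ≠ i)
    (hρ : Involutive ρ) (hρ' : ∀ i, ρ i ≠ i) (h : ∀ i, ρ i < i ↔ π i < i) (b : Fin m) :
    #(openArcs ρ b) = #(openArcs π b) := by
  have h' : ∀ i, i < ρ i ↔ i < π i := fun i => by
    have := h i; have := hπ' i; have := hρ' i; grind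
  have h₁ := card_openArcs_add hπ b
  have h₂ := card_openArcs_add hρ b
  simp only [h, h'] at h₂
  omega

theorem closerNestings_eq_card_openArcs {π : Fin m → Fin m} (hπ : Involutive π) {b : Fin m}
    (hb : π b < b) : closerNestings π b = #{c ∈ openArcs π b | c < π b} := by
  unfold closerNestings openArcs
  congr 1
  ext c
  have := hπ c
  simp only [mem_filter, mem_univ, true_and]
  grind

theorem closerCrossings_eq_card_openArcs {π : Fin m → Fin m} (hπ : Involutive π) (b : Fin m) :
    closerCrossings π b = #{c ∈ openArcs π b | π b < c} := by
  unfold closerCrossings openArcs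
  congr 1
  ext c
  have := hπ c
  simp only [mem_filter, mem_univ, true_and]
  grind

theorem closerNestings_add_closerCrossings {π : Fin m → Fin m} (hπ : Involutive π) {b : Fin m}
    (hb : π b < b) :
    closerNestings π b + closerCrossings π b + 1 = #(openArcs π b) := by
  have hmem : π b ∈ openArcs π b := mem_openArcs.2 ⟨hb, (hπ b).ge⟩
  rw [closerNestings_eq_card_openArcs hπ hb, closerCrossings_eq_card_openArcs hπ,
    ← card_erase_add_one hmem, ← card_union_of_disjoint]
  · congr 2
    ext c
    simp only [mem_union, mem_filter, mem_erase]
    grind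
  · rw [disjoint_left]
    simp only [mem_filter]
    grind

theorem closerNestings_of_le {π : Fin m → Fin m} {b : Fin m} (hb : b ≤ π b) :
    closerNestings π b = 0 := by
  simp only [closerNestings, card_eq_zero, filter_eq_empty_iff]
  grind

theorem closerCrossings_of_le {π : Fin m → Fin m} {b : Fin m} (hb : b ≤ π b) :
    closerCrossings π b = 0 := by
  simp only [closerCrossings, card_eq_zero, filter_eq_empty_iff]
  grind

theorem Finset.exists_mem_card_filter_lt_eq {α : Type*} [LinearOrder α] (s : Finset α) {k : ℕ}
    (hk : k < #s) : ∃ a ∈ s, #{c ∈ s | c < a} = k := by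
  induction s using Finset.induction_on_max with
  | empty => simp at hk
  | insert a s ha ih =>
    have hnot : a ∉ s := fun h => lt_irrefl _ (ha a h)
    rw [card_insert_of_notMem hnot] at hk
    rcases Nat.lt_succ_iff_lt_or_eq.1 hk with hk | rfl
    · obtain ⟨x, hx, rfl⟩ := ih hk
      refine ⟨x, mem_insert_of_mem hx, ?_⟩
      rw [filter_insert, if_neg (ha x hx).not_gt]
    · refine ⟨a, mem_insert_self _ _, ?_⟩
      rw [filter_insert, if_neg (lt_irrefl a), filter_true_of_mem ha]

theorem Finset.card_filter_lt_injOn {α : Type*} [LinearOrder α] (s : Finset α) :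
    Set.InjOn (fun a => #{c ∈ s | c < a}) s := by
  have key : ∀ a ∈ s, ∀ b, a < b → #{c ∈ s | c < a} < #{c ∈ s | c < b} := by
    intro a ha b hab
    refine card_lt_card ⟨fun c => ?_, fun h => ?_⟩
    · simp only [mem_filter]
      exact fun hc => ⟨hc.1, hc.2.trans hab⟩
    · exact lt_irrefl a (mem_filter.1 (h (mem_filter.2 ⟨ha, hab⟩))).2
  intro a ha b hb hab
  rcases lt_trichotomy a b with h | h | h
  · exact absurd hab (key a ha b h).ne
  · exact h
  · exact absurd hab (key b hb a h).ne'

/-- A fixed-point-free involution is determined by its closers and their nesting numbers. -/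
theorem eq_of_closerNestings_eq {π ρ : Fin m → Fin m} (hπ : Involutive π) (hπ' : ∀ i, π i ≠ i)
    (hρ : Involutive ρ) (hρ' : ∀ i, ρ i ≠ i) (h : ∀ i, ρ i < i ↔ π i < i)
    (hne : ∀ i, closerNestings ρ i = closerNestings π i) : ρ = π := by
  have key : ∀ b, π b < b → ρ b = π b := by
    intro b
    induction b using WellFoundedLT.induction with
    | ind b ih =>
      intro hb
      have hopen : openArcs ρ b = openArcs π b := by
        ext c
        simp only [mem_openArcs]
        refine and_congr_right fun hc => not_iff_not.1 ?_
        simp only [not_le]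
        have h₁ := hπ c
        have h₂ := hρ c
        have h₃ := hρ' c
        have h₇ := hπ' c
        have h₄ := ih c hc
        have h₅ := h c
        have h₆ := h (ρ c)
        constructor <;> intro hlt
        · have := ih (ρ c) hlt
          have := hπ (ρ c)
          grind
        · have := ih (π c) hlt
          have := hρ (π c)
          grind
      have hb' : ρ b < b := (h b).2 hb
      refine card_filter_lt_injOn (openArcs π b) ?_ ?_ ?_
      · rw [← hopen]
        exact mem_coe.2 (mem_openArcs.2 ⟨hb', (hρ b).ge⟩)
      · exact mem_coe.2 (mem_openArcs.2 ⟨hb, (hπ b).ge⟩)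
      · have := hne b
        rwa [closerNestings_eq_card_openArcs hρ hb', closerNestings_eq_card_openArcs hπ hb,
          hopen] at this
  funext x
  rcases lt_or_gt_of_ne (hπ' x) with hx | hx
  · exact key x hx
  · have := key (π x) (by rwa [hπ x])
    rw [hπ x] at this
    exact (hρ.eq_iff.1 this).symm

/-- Rewiring the arcs so that the closer `b` gets any prescribed nesting number, without changing
the set of closers or the nesting numbers of the earlier closers. -/
theorem exists_rewire {π : Fin m → Fin m} (hπ : Involutive π) (hπ' : ∀ i, π i ≠ i) {b : Fin m}
    (hb : π b < b) {k : ℕ} (hk : k < #(openArcs π b)) :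
    ∃ ρ : Fin m → Fin m, Involutive ρ ∧ (∀ i, ρ i ≠ i) ∧ (∀ i, ρ i < i ↔ π i < i) ∧
      (∀ i < b, closerNestings ρ i = closerNestings π i) ∧ closerNestings ρ b = k := by
  obtain ⟨a, ha, rfl⟩ := (openArcs π b).exists_mem_card_filter_lt_eq hk
  obtain ⟨hab, hba⟩ := mem_openArcs.1 ha
  set τ := Equiv.swap (π b) a with hτ
  have hττ : ∀ x, τ (τ x) = x := Equiv.swap_apply_self _ _
  have hτ_of_le : ∀ x, b ≤ x → τ x = x := fun x hx =>
    Equiv.swap_apply_of_ne_of_ne (by grind) (by grind)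
  have hτ_lt : ∀ x, x < b → τ x < b := by
    intro x hx
    by_contra! hle
    have h₁ := hτ_of_le _ hle
    rw [hττ] at h₁
    grind
  have hπb := hπ b
  have hlt : ∀ i < b, π i < b → τ (π (τ i)) = π i := by
    intro i hi hi'
    have hi₁ : τ i = i := Equiv.swap_apply_of_ne_of_ne (by grind) (by grind)
    have hii := hπ i
    have hia := hπ a
    rw [hi₁]
    exact Equiv.swap_apply_of_ne_of_ne (by grind) (by grind)
  have hle : ∀ i < b, b ≤ π i → b ≤ τ (π (τ i)) := by
    intro i hi hi'
    have hmem : b ≤ π (τ i) := by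
      by_cases h₁ : i = π b
      · rw [h₁, hτ, Equiv.swap_apply_left]; exact hba
      by_cases h₂ : i = a
      · rw [h₂, hτ, Equiv.swap_apply_right, hπb]
      · rwa [hτ, Equiv.swap_apply_of_ne_of_ne h₁ h₂]
    rwa [hτ_of_le _ hmem]
  have hinv : Involutive fun i => τ (π (τ i)) := fun i => by simp only [hττ, hπ _]
  have hb_new : τ (π (τ b)) = a := by
    rw [hτ_of_le b le_rfl, hτ, Equiv.swap_apply_left]
  refine ⟨fun i => τ (π (τ i)), hinv, fun i h => hπ' (τ i) ?_, fun i => ?_, fun i hi => ?_, ?_⟩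
  · have := congrArg τ h
    rwa [hττ] at this
  · dsimp only
    rcases lt_or_ge i b with hi | hi
    · have h₁ := hlt i hi
      have h₂ := hle i hi
      grind
    · rw [hτ_of_le i hi]
      have h₁ := hτ_of_le (π i)
      have h₂ := hτ_lt (π i)
      grind
  · unfold closerNestings
    congr 1
    ext c
    simp only [mem_filter, mem_univ, true_and]
    have h₁ := hlt i hi
    have h₂ := hle i hi
    have h₃ := hlt c
    have h₄ := hle c
    grind
  · rw [closerNestings_eq_card_openArcs hinv (by simpa only [hb_new] using hab)]
    simp only [hb_new]
    congr 1
    ext c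
    simp only [mem_filter, mem_openArcs]
    have h₃ := hlt c
    have h₄ := hle c
    grind

/-- Every fixed-point-free involution has a mirror with the same closers, in which the arcs crossed
at a closer and the arcs enclosing it exchange their numbers. -/
theorem exists_closerNestings_eq_closerCrossings {π : Fin m → Fin m} (hπ : Involutive π)
    (hπ' : ∀ i, π i ≠ i) :
    ∃ ρ : Fin m → Fin m, Involutive ρ ∧ (∀ i, ρ i ≠ i) ∧ (∀ i, ρ i < i ↔ π i < i) ∧
      ∀ i, closerNestings ρ i = closerCrossings π i := by
  suffices H : ∀ k : ℕ, ∃ ρ : Fin m → Fin m, Involutive ρ ∧ (∀ i, ρ i ≠ i) ∧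
      (∀ i, ρ i < i ↔ π i < i) ∧
        ∀ i : Fin m, (i : ℕ) < k → closerNestings ρ i = closerCrossings π i by
    obtain ⟨ρ, h₁, h₂, h₃, h₄⟩ := H m
    exact ⟨ρ, h₁, h₂, h₃, fun i => h₄ i i.2⟩
  intro k
  induction k with
  | zero => exact ⟨π, hπ, hπ', fun _ => Iff.rfl, fun i hi => absurd hi (Nat.not_lt_zero _)⟩
  | succ k ih =>
    obtain ⟨ρ, hρ, hρ', hcl, hne⟩ := ih
    by_cases hk : k < m
    · set b : Fin m := ⟨k, hk⟩ with hbk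
      have split : ∀ i : Fin m, (i : ℕ) < k + 1 → i < b ∨ i = b := fun i hi => by
        rw [← le_iff_lt_or_eq, Fin.le_def]
        exact Nat.lt_succ_iff.1 hi
      by_cases hb : π b < b
      · have hcard : closerCrossings π b < #(openArcs ρ b) := by
          have := closerNestings_add_closerCrossings hπ hb
          rw [card_openArcs_congr hπ hπ' hρ hρ' hcl]
          omega
        obtain ⟨ρ', h₁, h₂, h₃, h₄, h₅⟩ := exists_rewire hρ hρ' ((hcl b).2 hb) hcard
        refine ⟨ρ', h₁, h₂, fun i => (h₃ i).trans (hcl i), fun i hi => ?_⟩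
        rcases split i hi with hi | rfl
        · rw [h₄ i hi, hne i hi]
        · exact h₅
      · refine ⟨ρ, hρ, hρ', hcl, fun i hi => ?_⟩
        rcases split i hi with hi | rfl
        · exact hne i hi
        · rw [closerCrossings_of_le (not_lt.1 hb),
            closerNestings_of_le (not_lt.1 ((hcl _).not.2 hb))]
    · exact ⟨ρ, hρ, hρ', hcl, fun i _ => hne i (by omega)⟩

theorem closerCrossings_eq_closerNestings {π ρ : Fin m → Fin m} (hπ : Involutive π)
    (hπ' : ∀ i, π i ≠ i) (hρ : Involutive ρ) (hρ' : ∀ i, ρ i ≠ i) (h : ∀ i, ρ i < i ↔ π i < i)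
    (hne : ∀ i, closerNestings ρ i = closerCrossings π i) (i : Fin m) :
    closerCrossings ρ i = closerNestings π i := by
  by_cases hi : π i < i
  · have h₁ := closerNestings_add_closerCrossings hπ hi
    have h₂ := closerNestings_add_closerCrossings hρ ((h i).2 hi)
    have h₃ := card_openArcs_congr hπ hπ' hρ hρ' h i
    have h₄ := hne i
    omega
  · rw [closerNestings_of_le (not_lt.1 hi), closerCrossings_of_le (not_lt.1 ((h i).not.2 hi))]

theorem exists_involution_swapping_closer_statistics (m : ℕ) :
    ∃ σ : FPFInvolution m → FPFInvolution m, Involutive σ ∧ ∀ π i,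
      closerNestings (σ π).1 i = closerCrossings π.1 i ∧
        closerCrossings (σ π).1 i = closerNestings π.1 i := by
  choose σ h₁ h₂ h₃ h₄ using fun π : FPFInvolution m =>
    exists_closerNestings_eq_closerCrossings π.2.1 π.2.2
  have h₅ := fun π : FPFInvolution m =>
    closerCrossings_eq_closerNestings π.2.1 π.2.2 (h₁ π) (h₂ π) (h₃ π) (h₄ π)
  refine ⟨fun π => ⟨σ π, h₁ π, h₂ π⟩, fun π => Subtype.ext ?_, fun π i => ⟨h₄ π i, h₅ π i⟩⟩
  exact eq_of_closerNestings_eq π.2.1 π.2.2 (h₁ _) (h₂ _) (fun i => (h₃ _ i).trans (h₃ π i))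
    fun i => (h₄ _ i).trans (h₅ π i)

/-- The set of arcs `{i, π i}`. -/
def arcs (π : Fin m → Fin m) : Finset (Finset (Fin m)) :=
  univ.image fun i => {i, π i}

theorem pair_self_mem_arcs (π : Fin m → Fin m) (i : Fin m) : {i, π i} ∈ arcs π :=
  mem_image_of_mem _ (mem_univ i)

theorem eq_apply_of_pair_mem_arcs {π : Fin m → Fin m} (hπ : Involutive π) {a b : Fin m}
    (hab : a ≠ b) (h : {a, b} ∈ arcs π) : b = π a := by
  obtain ⟨i, -, hi⟩ := mem_image.1 h
  have ha : a ∈ ({i, π i} : Finset (Fin m)) := hi ▸ by simp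
  have hb : b ∈ ({i, π i} : Finset (Fin m)) := hi ▸ by simp
  simp only [mem_insert, mem_singleton] at ha hb
  have := hπ i
  grind

theorem Finset.pair_eq_pair_of_lt {α : Type*} [LinearOrder α] {a b c d : α} (hab : a < b)
    (hcd : c < d) (h : ({a, b} : Finset α) = {c, d}) : a = c ∧ b = d := by
  have h₁ := Finset.ext_iff.1 h a
  have h₂ := Finset.ext_iff.1 h b
  have h₃ := Finset.ext_iff.1 h c
  simp only [mem_insert, mem_singleton] at h₁ h₂ h₃
  grind

/-- Counting pairs of arcs in a given relative position by right end of the first arc. -/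
theorem natCard_arc_pairs {π : Fin m → Fin m} (hπ : Involutive π)
    (P : Fin m → Fin m → Fin m → Fin m → Prop) [∀ a b c d, Decidable (P a b c d)]
    (hP : ∀ a b c d, P a b c d → a < b ∧ c < d) :
    Nat.card {pq : Finset (Fin m) × Finset (Fin m) // pq.1 ∈ arcs π ∧ pq.2 ∈ arcs π ∧
      ∃ a b c d : Fin m, pq.1 = {a, b} ∧ pq.2 = {c, d} ∧ P a b c d} =
    ∑ i, #{c | P (π i) i c (π c)} := by
  rw [← card_sigma, ← Nat.card_eq_finsetCard]
  symm
  refine Nat.card_eq_of_bijective (fun x => ⟨({π x.1.1, x.1.1}, {x.1.2, π x.1.2}), ?_⟩) ⟨?_, ?_⟩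
  · have hx := (mem_filter.1 (mem_sigma.1 x.2).2).2
    refine ⟨?_, pair_self_mem_arcs π _, _, _, _, _, rfl, rfl, hx⟩
    rw [pair_comm]
    exact pair_self_mem_arcs π _
  · rintro ⟨⟨i, c⟩, hx⟩ ⟨⟨j, d⟩, hy⟩ h
    simp only [mem_sigma, mem_filter, mem_univ, true_and] at hx hy
    simp only [Subtype.mk.injEq, Prod.mk.injEq] at h
    obtain ⟨-, rfl⟩ := pair_eq_pair_of_lt (hP _ _ _ _ hx).1 (hP _ _ _ _ hy).1 h.1
    obtain ⟨rfl, -⟩ := pair_eq_pair_of_lt (hP _ _ _ _ hx).2 (hP _ _ _ _ hy).2 h.2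
    rfl
  · rintro ⟨⟨p, q⟩, hp, hq, a, b, c, d, hpab, hqcd, h⟩
    dsimp only at hp hq hpab hqcd
    subst hpab hqcd
    obtain rfl := eq_apply_of_pair_mem_arcs hπ (hP _ _ _ _ h).1.ne hp
    obtain rfl := eq_apply_of_pair_mem_arcs hπ (hP _ _ _ _ h).2.ne hq
    exact ⟨⟨⟨π a, c⟩, by simpa [hπ a] using h⟩, by simp [hπ a]⟩

end FixedPointFreeInvolutions

theorem isPerfectMatching_arcs {n : ℕ} {π : Fin (2 * n) → Fin (2 * n)} (hπ : Involutive π)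
    (hπ' : ∀ i, π i ≠ i) : IsPerfectMatching n (arcs π) := by
  refine ⟨fun p hp => ?_, fun i => ⟨{i, π i}, ⟨pair_self_mem_arcs π i, by simp⟩, ?_⟩⟩
  · obtain ⟨i, -, rfl⟩ := mem_image.1 hp
    exact card_pair (hπ' i).symm
  · rintro p ⟨hp, hi⟩
    obtain ⟨j, -, rfl⟩ := mem_image.1 hp
    rcases mem_insert.1 hi with rfl | hi
    · rfl
    · obtain rfl := mem_singleton.1 hi
      rw [hπ j, pair_comm]

theorem exists_eq_arcs {n : ℕ} {M : Finset (Finset (Fin (2 * n)))} (hM : IsPerfectMatching n M) :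
    ∃ π : Fin (2 * n) → Fin (2 * n), Involutive π ∧ (∀ i, π i ≠ i) ∧ arcs π = M := by
  have hpartner : ∀ i, ∃ j, j ≠ i ∧ {i, j} ∈ M := by
    intro i
    obtain ⟨p, ⟨hp, hi⟩, -⟩ := hM.2 i
    obtain ⟨x, y, hxy, rfl⟩ := card_eq_two.1 (hM.1 p hp)
    rcases mem_insert.1 hi with rfl | hi
    · exact ⟨y, hxy.symm, hp⟩
    · obtain rfl := mem_singleton.1 hi
      exact ⟨x, hxy, by rwa [pair_comm]⟩
  choose π hπ' hπM using hpartner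
  have huniq : ∀ i, ∀ p ∈ M, i ∈ p → p = {i, π i} := fun i p hp hi =>
    (hM.2 i).unique ⟨hp, hi⟩ ⟨hπM i, by simp⟩
  refine ⟨π, fun i => ?_, hπ', ?_⟩
  · have h := huniq (π i) _ (hπM i) (by simp)
    have hi : i ∈ ({π i, π (π i)} : Finset _) := h ▸ by simp
    simp only [mem_insert, mem_singleton] at hi
    have := hπ' i
    grind
  · ext p
    constructor
    · intro hp
      obtain ⟨i, -, rfl⟩ := mem_image.1 hp
      exact hπM i
    · intro hp
      obtain ⟨i, hi⟩ := card_pos.1 (by rw [hM.1 p hp]; norm_num : 0 < #p)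
      rw [huniq i p hp hi]
      exact pair_self_mem_arcs π i

/-- Fixed-point-free involutions of `Fin (2 * n)` are the same as perfect matchings. -/
noncomputable def fpfInvolutionEquiv (n : ℕ) :
    FPFInvolution (2 * n) ≃ {M : Finset (Finset (Fin (2 * n))) // IsPerfectMatching n M} :=
  Equiv.ofBijective (fun π => ⟨arcs π.1, isPerfectMatching_arcs π.2.1 π.2.2⟩) <| by
    refine ⟨fun π ρ h => Subtype.ext (funext fun i => ?_), fun M => ?_⟩
    · have h' : arcs π.1 = arcs ρ.1 := congrArg Subtype.val h
      exact eq_apply_of_pair_mem_arcs ρ.2.1 (π.2.2 i).symm (h' ▸ pair_self_mem_arcs π.1 i)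
    · obtain ⟨π, h₁, h₂, h₃⟩ := exists_eq_arcs M.2
      exact ⟨⟨π, h₁, h₂⟩, Subtype.ext h₃⟩

theorem crCount_arcs {n : ℕ} {π : Fin (2 * n) → Fin (2 * n)} (hπ : Involutive π) :
    crCount n (arcs π) = ∑ i, closerCrossings π i :=
  natCard_arc_pairs hπ (fun a b c d => a < c ∧ c < b ∧ b < d) fun _ _ _ _ h =>
    ⟨h.1.trans h.2.1, h.2.1.trans h.2.2⟩

theorem neCount_arcs {n : ℕ} {π : Fin (2 * n) → Fin (2 * n)} (hπ : Involutive π) :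
    neCount n (arcs π) = ∑ i, closerNestings π i :=
  natCard_arc_pairs hπ (fun a b c d => c < a ∧ a < b ∧ b < d) fun _ _ _ _ h =>
    ⟨h.2.1, (h.1.trans h.2.1).trans h.2.2⟩

/-- **(de Médicis–Viennot involution.)**  For every `n` there is an involution `σ` on the set
of perfect matchings of `[2n]` with `cr(M) = ne(σ(M))` and `ne(M) = cr(σ(M))` for all `M`. -/
theorem exists_crossing_nesting_involution (n : ℕ) :
    ∃ σ : {M : Finset (Finset (Fin (2 * n))) // IsPerfectMatching n M} →
        {M : Finset (Finset (Fin (2 * n))) // IsPerfectMatching n M},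
      σ ∘ σ = id ∧
        ∀ M, crCount n M.1 = neCount n (σ M).1 ∧ neCount n M.1 = crCount n (σ M).1 := by
  obtain ⟨σ, hσ, hstat⟩ := exists_involution_swapping_closer_statistics (2 * n)
  let e := fpfInvolutionEquiv n
  refine ⟨fun M => e (σ (e.symm M)), funext fun M => by simp [hσ _], fun M => ?_⟩
  obtain ⟨π, rfl⟩ := e.surjective M
  dsimp only
  rw [e.symm_apply_apply]
  change crCount n (arcs π.1) = neCount n (arcs (σ π).1) ∧
    neCount n (arcs π.1) = crCount n (arcs (σ π).1)
  simp only [crCount_arcs π.2.1, neCount_arcs π.2.1, crCount_arcs (σ π).2.1,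
    neCount_arcs (σ π).2.1, hstat, and_self]
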